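/- arXiv:1307.4354 — 3 statements merged into one kernel-verified Lean document; each statement's English description precedes it below -/
import Mathlib

section
/- Let $n \ge 1$ and let $A$ be a real $n \times n$ matrix that is strictly diagonally dominant by rows, and set $c = \min_k\big(|a_{kk}| - \sum_{j \ne k} |a_{kj}|\big) > 0$. Then $A$ is invertible and $\|A^{-1}\|_\infty \le 1/c$. -/
/-- A uniform gap in row diagonal dominance bounds a matrix below in the sup norm. -/
theorem Matrix.mul_norm_le_norm_mulVec_of_diag_gap {ι : Type*} [Fintype ι] [DecidableEq ι]
    (A : Matrix ι ι ℝ) (c : ℝ)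
    (hc : ∀ k, c ≤ |A k k| - ∑ j ∈ Finset.univ.erase k, |A k j|) (x : ι → ℝ) :
    c * ‖x‖ ≤ ‖A.mulVec x‖ := by
  cases isEmpty_or_nonempty ι with
  | inl h => simp [Subsingleton.elim x 0]
  | inr h =>
    obtain ⟨k, hk⟩ := Finite.exists_max fun i => |x i|
    have hx : ‖x‖ = |x k| :=
      le_antisymm ((pi_norm_le_iff_of_nonneg (abs_nonneg _)).2 hk) (norm_le_pi_norm x k)
    have hrow : A.mulVec x k = A k k * x k + ∑ j ∈ Finset.univ.erase k, A k j * x j :=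
      (Finset.add_sum_erase _ _ (Finset.mem_univ k)).symm
    have hoff : |∑ j ∈ Finset.univ.erase k, A k j * x j| ≤
        (∑ j ∈ Finset.univ.erase k, |A k j|) * |x k| := by
      rw [Finset.sum_mul]
      refine (Finset.abs_sum_le_sum_abs _ _).trans (Finset.sum_le_sum fun j _ => ?_)
      rw [abs_mul]
      exact mul_le_mul_of_nonneg_left (hk j) (abs_nonneg _)
    calc c * ‖x‖ ≤ (|A k k| - ∑ j ∈ Finset.univ.erase k, |A k j|) * |x k| := by
          rw [hx]
          exact mul_le_mul_of_nonneg_right (hc k) (abs_nonneg _)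
      _ ≤ |A k k * x k| - |∑ j ∈ Finset.univ.erase k, A k j * x j| := by
          rw [sub_mul, abs_mul]
          exact sub_le_sub_left hoff _
      _ ≤ |A.mulVec x k| := by
          rw [hrow]
          exact abs_sub_abs_le_abs_add _ _
      _ ≤ ‖A.mulVec x‖ := norm_le_pi_norm (A.mulVec x) k

/-- **Varah's bound.** If a real `n × n` matrix `A` is strictly diagonally dominant by
rows and `c = min_k (|a_kk| - ∑_{j ≠ k} |a_kj|)`, then `A` is invertible and
`‖A⁻¹‖_∞ ≤ 1/c`, stated via the operator-norm characterization
`‖A⁻¹ v‖_∞ ≤ (1/c) ‖v‖_∞` for all vectors `v` (the norm on `Fin n → ℝ` is the sup norm). -/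
theorem varah_bound (n : ℕ) (hn : 1 ≤ n) (A : Matrix (Fin n) (Fin n) ℝ)
    (hdd : ∀ k, ∑ j ∈ Finset.univ.erase k, |A k j| < |A k k|)
    (c : ℝ)
    (hc : c = Finset.univ.inf'
      (by have : Nonempty (Fin n) := Fin.pos_iff_nonempty.mp hn; exact Finset.univ_nonempty)
      (fun k => |A k k| - ∑ j ∈ Finset.univ.erase k, |A k j|)) :
    IsUnit A ∧ ∀ v : Fin n → ℝ, ‖A⁻¹.mulVec v‖ ≤ (1 / c) * ‖v‖ := by
  have hdet : IsUnit A.det := (det_ne_zero_of_sum_row_lt_diag hdd).isUnit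
  have hpos : 0 < c := by
    rw [hc, Finset.lt_inf'_iff]
    exact fun k _ => sub_pos.2 (hdd k)
  refine ⟨(Matrix.isUnit_iff_isUnit_det A).2 hdet, fun v => ?_⟩
  have hbound := A.mul_norm_le_norm_mulVec_of_diag_gap c
    (fun k => hc ▸ Finset.inf'_le _ (Finset.mem_univ k)) (A⁻¹.mulVec v)
  rw [Matrix.mulVec_mulVec, Matrix.mul_nonsing_inv A hdet, Matrix.one_mulVec] at hbound
  rw [one_div_mul_eq_div, le_div_iff₀ hpos, mul_comm]
  exact hbound
end

section
/- Let $n \ge 1$, $c > 0$, and let $A$ be a real $n \times n$ matrix with positive diagonal entries $a_{kk} > 0$, non-positive off-diagonal entries $a_{kj} \le 0$ for $k \ne j$, and every row summing to $c$, i.e., $a_{kk} + \sum_{j \ne k} a_{kj} = c$ for all $k$. Then for every $k$, $|a_{kk}| - \sum_{j \ne k} |a_{kj}| = c$; consequently $A$ is strictly diagonally dominant by rows, invertible, and $\|A^{-1}\|_\infty \le 1/c$. -/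
/-- If every row of `A` is diagonally dominant with margin at least `c`, then `A` expands the
sup norm by a factor of at least `c`. -/
theorem Matrix.mul_norm_le_norm_mulVec_of_le_diag_sub_sum {ι : Type*} [Fintype ι] [DecidableEq ι]
    {c : ℝ} {A : Matrix ι ι ℝ}
    (h : ∀ k, c ≤ |A k k| - ∑ j ∈ Finset.univ.erase k, |A k j|) (w : ι → ℝ) :
    c * ‖w‖ ≤ ‖A.mulVec w‖ := by
  cases isEmpty_or_nonempty ι
  · simp [Subsingleton.elim w 0]
  obtain ⟨k, hk⟩ := Finite.exists_max fun i => |w i|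
  have hw : ‖w‖ = |w k| :=
    le_antisymm ((pi_norm_le_iff_of_nonneg (abs_nonneg _)).2 hk) (norm_le_pi_norm w k)
  have hsum : |∑ j ∈ Finset.univ.erase k, A k j * w j|
      ≤ (∑ j ∈ Finset.univ.erase k, |A k j|) * |w k| := by
    rw [Finset.sum_mul]
    refine (Finset.abs_sum_le_sum_abs _ _).trans (Finset.sum_le_sum fun j _ => ?_)
    rw [abs_mul]
    exact mul_le_mul_of_nonneg_left (hk j) (abs_nonneg _)
  have hdiag : A k k * w k = A.mulVec w k - ∑ j ∈ Finset.univ.erase k, A k j * w j := by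
    rw [Matrix.mulVec, dotProduct, ← Finset.add_sum_erase _ _ (Finset.mem_univ k),
      add_sub_cancel_right]
  have htri : |A k k| * |w k|
      ≤ |A.mulVec w k| + |∑ j ∈ Finset.univ.erase k, A k j * w j| := by
    rw [← abs_mul, hdiag]
    exact abs_sub _ _
  calc c * ‖w‖ ≤ (|A k k| - ∑ j ∈ Finset.univ.erase k, |A k j|) * |w k| := by
        rw [hw]
        exact mul_le_mul_of_nonneg_right (h k) (abs_nonneg _)
    _ ≤ |A.mulVec w k| := by linarith
    _ ≤ ‖A.mulVec w‖ := norm_le_pi_norm (A.mulVec w) k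

/-- An M-matrix-type result: if `A` has positive diagonal entries, non-positive
off-diagonal entries, and each row summing to `c > 0`, then for every row
`|a_kk| - ∑_{j ≠ k} |a_kj| = c`; consequently `A` is strictly diagonally dominant
by rows, invertible, and `‖A⁻¹‖_∞ ≤ 1/c` (operator-norm characterization,
with the sup norm on `Fin n → ℝ`). -/
theorem mmatrix_row_sums (n : ℕ) (hn : 1 ≤ n) (c : ℝ) (hc : 0 < c)
    (A : Matrix (Fin n) (Fin n) ℝ)
    (hdiag : ∀ k, 0 < A k k)
    (hoff : ∀ k j, k ≠ j → A k j ≤ 0)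
    (hrow : ∀ k, A k k + ∑ j ∈ Finset.univ.erase k, A k j = c) :
    (∀ k, |A k k| - ∑ j ∈ Finset.univ.erase k, |A k j| = c) ∧
    (∀ k, ∑ j ∈ Finset.univ.erase k, |A k j| < |A k k|) ∧
    IsUnit A ∧ ∀ v : Fin n → ℝ, ‖A⁻¹.mulVec v‖ ≤ (1 / c) * ‖v‖ := by
  have hgap : ∀ k, |A k k| - ∑ j ∈ Finset.univ.erase k, |A k j| = c := by
    intro k
    have habs : ∑ j ∈ Finset.univ.erase k, |A k j| = -∑ j ∈ Finset.univ.erase k, A k j := by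
      rw [← Finset.sum_neg_distrib]
      exact Finset.sum_congr rfl fun j hj =>
        abs_of_nonpos (hoff k j (Finset.ne_of_mem_erase hj).symm)
    rw [abs_of_pos (hdiag k), habs, sub_neg_eq_add, hrow k]
  have hdom : ∀ k, ∑ j ∈ Finset.univ.erase k, |A k j| < |A k k| := fun k => by
    linarith [hgap k]
  have hdet : IsUnit A.det := (det_ne_zero_of_sum_row_lt_diag hdom).isUnit
  refine ⟨hgap, hdom, (Matrix.isUnit_iff_isUnit_det A).2 hdet, fun v => ?_⟩
  have hbound := Matrix.mul_norm_le_norm_mulVec_of_le_diag_sub_sum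
    (fun k => (hgap k).ge) (A⁻¹.mulVec v)
  rw [Matrix.mulVec_mulVec, Matrix.mul_nonsing_inv A hdet, Matrix.one_mulVec] at hbound
  rwa [one_div, le_inv_mul_iff₀ hc]
end

section
/- For every $h > 0$ and all $a, b$ with $0 < a < h$ and $0 < b < h$: $\dfrac{h-a}{h} \cdot \dfrac{h-b}{h} > 4 \cdot \dfrac{a(h-a)(2h-a)}{6h^3} \cdot \dfrac{(h+b)(h-b)(2h-b)}{2h^3}$. (This states that the bi-linear center weight $\omega_{11}$ dominates four times the absolute value of the bi-cubic edge weight $\bar{\omega}_{10}$, which is the key inequality ensuring non-negativity of the off-diagonal matrix entries corresponding to the eight edge points of the $4\times 4$ stencil.) -/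
/-- The bi-linear center weight dominates four times the absolute value of the
bi-cubic edge weight:
`((h-a)/h)·((h-b)/h) > 4 · (a(h-a)(2h-a)/(6h³)) · ((h+b)(h-b)(2h-b)/(2h³))`
for `0 < a < h`, `0 < b < h`. -/
theorem bilinear_gt_four_bicubic_edge (h a b : ℝ) (hh : 0 < h)
    (ha0 : 0 < a) (hah : a < h) (hb0 : 0 < b) (hbh : b < h) :
    (h - a) / h * ((h - b) / h)
      > 4 * (a * (h - a) * (2*h - a) / (6 * h^3))
          * ((h + b) * (h - b) * (2*h - b) / (2 * h^3)) := by
  have hP : a * (2 * h - a) ≤ h ^ 2 := by nlinarith [sq_nonneg (h - a)]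
  have hQ : (h + b) * (2 * h - b) ≤ 9 / 4 * h ^ 2 := by nlinarith [sq_nonneg (h - 2 * b)]
  have hQ0 : 0 ≤ (h + b) * (2 * h - b) := mul_nonneg (by linarith) (by linarith)
  have hPQ : a * (2 * h - a) * ((h + b) * (2 * h - b)) ≤ h ^ 2 * (9 / 4 * h ^ 2) :=
    mul_le_mul hP hQ hQ0 (by positivity)
  have hfactor : a * (2 * h - a) * ((h + b) * (2 * h - b)) / (3 * h ^ 4) < 1 := by
    rw [div_lt_one (by positivity)]
    nlinarith [pow_pos hh 4]
  have hlin : 0 < (h - a) / h * ((h - b) / h) :=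
    mul_pos (div_pos (sub_pos.2 hah) hh) (div_pos (sub_pos.2 hbh) hh)
  calc 4 * (a * (h - a) * (2*h - a) / (6 * h^3))
          * ((h + b) * (h - b) * (2*h - b) / (2 * h^3))
      = (h - a) / h * ((h - b) / h)
          * (a * (2 * h - a) * ((h + b) * (2 * h - b)) / (3 * h ^ 4)) := by
        field_simp
        ring
    _ < (h - a) / h * ((h - b) / h) := mul_lt_of_lt_one_right hlin hfactor
end
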